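/- arXiv:math/0402267 — 2 statements merged into one kernel-verified Lean document; each statement's English description precedes it below -/
import Mathlib

section
/- For every natural number n ≥ 1, the map μ : Sym^n(ℂ∖{0}) → ℂ∖{0} sending the class of (z_1, …, z_n) to the product z_1 ⋯ z_n is a continuous map which is a homotopy equivalence. In particular Sym^n(ℂ∖{0}) is homotopy equivalent to the circle. -/
/-- The setoid on `Fin n → X` identifying tuples that differ by a permutation
of the coordinates (the permutation action of the symmetric group `Σ_n`). -/
def permSetoid (n : ℕ) (X : Type*) : Setoid (Fin n → X) where
  r f g := ∃ σ : Equiv.Perm (Fin n), f ∘ σ = g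
  iseqv := by
    refine ⟨fun f => ⟨Equiv.refl _, rfl⟩, ?_, ?_⟩
    · rintro f g ⟨σ, rfl⟩
      exact ⟨σ.symm, by ext i; simp⟩
    · rintro f g h ⟨σ, rfl⟩ ⟨τ, rfl⟩
      exact ⟨τ.trans σ, rfl⟩

/-- The `n`-th symmetric product of `X`: the quotient of `X^n` by the
permutation action of the symmetric group `Σ_n`, with the quotient topology. -/
def SymProd (n : ℕ) (X : Type*) : Type _ := Quotient (permSetoid n X)

instance (n : ℕ) (X : Type*) [TopologicalSpace X] : TopologicalSpace (SymProd n X) :=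
  inferInstanceAs (TopologicalSpace (Quotient (permSetoid n X)))

/-- The class of a tuple in the symmetric product. -/
def SymProd.mk {n : ℕ} {X : Type*} (f : Fin n → X) : SymProd n X :=
  Quotient.mk (permSetoid n X) f

open Polynomial Topology

/-- Two finite families with the same multiset of values differ by a permutation. -/
theorem exists_perm_comp_eq_of_map_univ_eq {ι X : Type*} [Fintype ι] {f g : ι → X}
    (h : Finset.univ.val.map f = Finset.univ.val.map g) :
    ∃ σ : Equiv.Perm ι, f ∘ σ = g := by
  classical
  have e : ∀ c, Nonempty ({i // g i = c} ≃ {i // f i = c}) := fun c => by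
    have hc := congrArg (Multiset.count c) h
    rw [Multiset.count_map, Multiset.count_map] at hc
    refine Fintype.card_eq.mp ?_
    rw [Fintype.card_subtype, Fintype.card_subtype, Finset.card_def, Finset.card_def,
      Finset.filter_val, Finset.filter_val]
    simpa only [eq_comm] using hc.symm
  let τ := Equiv.ofFiberEquiv fun c => (e c).some
  exact ⟨τ, funext fun i => Equiv.ofFiberEquiv_map (fun c => (e c).some) i⟩

/-- The lower coefficients of the monic polynomial of degree `n` with given roots. -/
noncomputable def rootsToCoeffs (n : ℕ) (z : Fin n → ℂ) (k : Fin n) : ℂ :=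
  (∏ i, (X - C (z i))).coeff k

theorem natDegree_prod_X_sub_C_fin {n : ℕ} (z : Fin n → ℂ) :
    (∏ i, (X - C (z i))).natDegree = n := by
  rw [natDegree_prod_of_monic _ _ fun i _ => monic_X_sub_C (z i)]
  simp

theorem monic_prod_X_sub_C_fin {n : ℕ} (z : Fin n → ℂ) :
    (∏ i, (X - C (z i))).Monic :=
  monic_prod_of_monic _ _ fun i _ => monic_X_sub_C (z i)

theorem continuous_coeff_prod_X_sub_C {ι : Type*} (s : Finset ι) (k : ℕ) :
    Continuous fun z : ι → ℂ => (∏ i ∈ s, (X - C (z i))).coeff k := by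
  classical
  induction s using Finset.induction_on generalizing k with
  | empty => simpa using continuous_const
  | insert a s ha ih =>
    simp only [Finset.prod_insert ha, sub_mul, coeff_sub, coeff_C_mul]
    refine Continuous.sub ?_ ((continuous_apply a).mul (ih k))
    cases k with
    | zero => simpa using continuous_const
    | succ k => simpa only [coeff_X_mul] using ih k

theorem continuous_rootsToCoeffs (n : ℕ) : Continuous (rootsToCoeffs n) :=
  continuous_pi fun k => continuous_coeff_prod_X_sub_C Finset.univ k

theorem rootsToCoeffs_comp_perm {n : ℕ} (z : Fin n → ℂ) (σ : Equiv.Perm (Fin n)) :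
    rootsToCoeffs n (z ∘ σ) = rootsToCoeffs n z := by
  ext k
  simp only [rootsToCoeffs, Function.comp_apply]
  rw [Equiv.prod_comp σ fun i => X - C (z i)]

theorem prod_X_sub_C_eq_of_rootsToCoeffs_eq {n : ℕ} {z w : Fin n → ℂ}
    (h : rootsToCoeffs n z = rootsToCoeffs n w) :
    ∏ i, (X - C (z i)) = ∏ i, (X - C (w i)) := by
  ext k
  rcases lt_trichotomy k n with hk | rfl | hk
  · exact congrFun h ⟨k, hk⟩
  · have hz := monic_prod_X_sub_C_fin z
    have hw := monic_prod_X_sub_C_fin w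
    rw [Monic, leadingCoeff, natDegree_prod_X_sub_C_fin] at hz hw
    rw [hz, hw]
  · rw [coeff_eq_zero_of_natDegree_lt (by rwa [natDegree_prod_X_sub_C_fin]),
      coeff_eq_zero_of_natDegree_lt (by rwa [natDegree_prod_X_sub_C_fin])]

theorem exists_perm_of_rootsToCoeffs_eq {n : ℕ} {z w : Fin n → ℂ}
    (h : rootsToCoeffs n z = rootsToCoeffs n w) : ∃ σ : Equiv.Perm (Fin n), z ∘ σ = w := by
  have roots_eq : ∀ v : Fin n → ℂ, (∏ i, (X - C (v i))).roots = Finset.univ.val.map v := fun v => by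
    rw [← roots_multiset_prod_X_sub_C (Finset.univ.val.map v), Multiset.map_map]
    rfl
  apply exists_perm_comp_eq_of_map_univ_eq
  rw [← roots_eq, ← roots_eq, prod_X_sub_C_eq_of_rootsToCoeffs_eq h]

theorem rootsToCoeffs_surjective (n : ℕ) : Function.Surjective (rootsToCoeffs n) := by
  intro w
  set q : ℂ[X] := ∑ k : Fin n, C (w k) * X ^ (k : ℕ) with hq
  have hdeg : q.degree < n := by
    exact degree_sum_fin_lt w
  set p : ℂ[X] := X ^ n + q with hp
  have hmonic : p.Monic := monic_X_pow_add hdeg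
  have hnat : p.natDegree = n := (natDegree_add_eq_left_of_degree_lt (by rwa [degree_X_pow])).trans
    (natDegree_X_pow n)
  have hsplit := IsAlgClosed.splits p
  have hcard : p.roots.card = n := by rw [← hsplit.natDegree_eq_card_roots, hnat]
  obtain ⟨l, hl⟩ := Quot.exists_rep p.roots
  have hl : (l : Multiset ℂ) = p.roots := hl
  have hlen : l.length = n := by rw [← hcard, ← hl, Multiset.coe_card]
  subst hlen
  refine ⟨l.get, funext fun k => ?_⟩
  have hprod : ∏ i, (X - C (l.get i)) = p := by
    rw [hsplit.eq_prod_roots_of_monic hmonic, ← hl]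
    simp [Fin.prod_univ_fun_getElem l fun a => X - C a]
  rw [rootsToCoeffs, hprod, hp, hq, coeff_add, coeff_X_pow, if_neg k.2.ne, zero_add,
    finsetSum_coeff]
  simp [coeff_X_pow, Fin.val_inj]

theorem isProperMap_rootsToCoeffs (n : ℕ) : IsProperMap (rootsToCoeffs n) := by
  refine isProperMap_iff_isCompact_preimage.mpr ⟨continuous_rootsToCoeffs n, fun K hK => ?_⟩
  obtain ⟨R, hR⟩ := hK.isBounded.exists_norm_le
  refine Metric.isCompact_of_isClosed_isBounded
    (hK.isClosed.preimage (continuous_rootsToCoeffs n))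
    (isBounded_iff_forall_norm_le.mpr ⟨R.toNNReal + 1, fun z hz => ?_⟩)
  refine (pi_norm_le_iff_of_nonneg (by positivity)).mpr fun i => ?_
  have hmonic := monic_prod_X_sub_C_fin z
  have hroot : (∏ i, (X - C (z i))).IsRoot (z i) := by
    rw [IsRoot.def, eval_prod]
    exact Finset.prod_eq_zero (Finset.mem_univ i) (by simp)
  have hlt := (hroot.norm_lt_cauchyBound hmonic.ne_zero).le
  have hbound : cauchyBound (∏ i, (X - C (z i))) ≤ R.toNNReal + 1 := by
    rw [cauchyBound, hmonic.leadingCoeff, nnnorm_one, div_one, natDegree_prod_X_sub_C_fin]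
    gcongr
    refine Finset.sup_le fun k hk => ?_
    rw [← norm_toNNReal]
    exact Real.toNNReal_le_toNNReal
      ((norm_le_pi_norm (rootsToCoeffs n z) ⟨k, Finset.mem_range.mp hk⟩).trans (hR _ hz))
  exact_mod_cast hlt.trans hbound

theorem isQuotientMap_rootsToCoeffs (n : ℕ) : IsQuotientMap (rootsToCoeffs n) :=
  (isProperMap_rootsToCoeffs n).isClosedMap.isQuotientMap (continuous_rootsToCoeffs n)
    (rootsToCoeffs_surjective n)

theorem rootsToCoeffs_zero {m : ℕ} (z : Fin (m + 1) → ℂ) :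
    rootsToCoeffs (m + 1) z 0 = (-1) ^ (m + 1) * ∏ i, z i := by
  rw [rootsToCoeffs, Fin.val_zero, coeff_zero_eq_eval_zero, eval_prod]
  simp [Finset.prod_neg]

/-- Lower coefficient vectors of monic polynomials of degree `m + 1` not vanishing at zero. -/
def nonzeroConstCoeffs (m : ℕ) : Set (Fin (m + 1) → ℂ) := {w | w 0 ≠ 0}

theorem continuous_nonzeroConstCoeffs_apply {m : ℕ} (k : Fin (m + 1)) :
    Continuous fun w : nonzeroConstCoeffs m => w.1 k :=
  (continuous_apply k).comp continuous_subtype_val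

theorem rootsToCoeffs_mem_nonzeroConstCoeffs_iff {m : ℕ} (z : Fin (m + 1) → ℂ) :
    rootsToCoeffs (m + 1) z ∈ nonzeroConstCoeffs m ↔ ∀ i, z i ≠ 0 := by
  simp [nonzeroConstCoeffs, rootsToCoeffs_zero, Finset.prod_eq_zero_iff]

/-- The map sending an unordered tuple of nonzero complex numbers to the coefficients of the monic
polynomial having these roots. -/
noncomputable def SymProd.toCoeffs (m : ℕ) (x : SymProd (m + 1) {z : ℂ // z ≠ 0}) :
    nonzeroConstCoeffs m :=
  Quotient.lift
    (fun f : Fin (m + 1) → {z : ℂ // z ≠ 0} =>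
      (⟨rootsToCoeffs (m + 1) fun i => f i,
        (rootsToCoeffs_mem_nonzeroConstCoeffs_iff _).mpr fun i => (f i).2⟩ :
          nonzeroConstCoeffs m))
    (by
      rintro f g ⟨σ, rfl⟩
      exact Subtype.ext (rootsToCoeffs_comp_perm (fun i => (f i : ℂ)) σ).symm) x

theorem SymProd.continuous_mk {n : ℕ} {X : Type*} [TopologicalSpace X] :
    Continuous (SymProd.mk : (Fin n → X) → SymProd n X) :=
  continuous_quotient_mk'

theorem SymProd.continuous_toCoeffs (m : ℕ) : Continuous (SymProd.toCoeffs m) :=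
  Continuous.quotient_lift
    (((continuous_rootsToCoeffs _).comp (by fun_prop)).subtype_mk _) _

theorem SymProd.toCoeffs_injective (m : ℕ) : Function.Injective (SymProd.toCoeffs m) := by
  rintro ⟨f⟩ ⟨g⟩ h
  obtain ⟨σ, hσ⟩ := exists_perm_of_rootsToCoeffs_eq (congrArg Subtype.val h)
  exact Quotient.sound ⟨σ, funext fun i => Subtype.ext (congrFun hσ i)⟩

theorem SymProd.isQuotientMap_toCoeffs (m : ℕ) : IsQuotientMap (SymProd.toCoeffs m) := by
  have hopen : IsOpen (nonzeroConstCoeffs m) :=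
    isOpen_ne.preimage (continuous_apply (0 : Fin (m + 1)))
  let s : rootsToCoeffs (m + 1) ⁻¹' nonzeroConstCoeffs m → SymProd (m + 1) {z : ℂ // z ≠ 0} :=
    fun z => SymProd.mk fun i =>
      ⟨z.1 i, (rootsToCoeffs_mem_nonzeroConstCoeffs_iff z.1).mp z.2 i⟩
  have hs : Continuous s := SymProd.continuous_mk.comp
    (continuous_pi fun i => ((continuous_apply i).comp continuous_subtype_val).subtype_mk _)
  exact IsQuotientMap.of_comp hs (SymProd.continuous_toCoeffs m)
    ((isQuotientMap_rootsToCoeffs (m + 1)).restrictPreimage_isOpen hopen)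

theorem SymProd.isHomeomorph_toCoeffs (m : ℕ) : IsHomeomorph (SymProd.toCoeffs m) :=
  isHomeomorph_iff_isQuotientMap_injective.mpr
    ⟨SymProd.isQuotientMap_toCoeffs m, SymProd.toCoeffs_injective m⟩

/-- Up to sign, taking the constant coefficient is a homotopy equivalence onto the punctured
plane; the other coefficients are contracted linearly. -/
noncomputable def nonzeroConstCoeffsHomotopyEquiv (m : ℕ) :
    ContinuousMap.HomotopyEquiv (nonzeroConstCoeffs m) {z : ℂ // z ≠ 0} where
  toFun :=
    { toFun := fun w => ⟨(-1) ^ (m + 1) * w.1 0, mul_ne_zero (by simp) w.2⟩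
      continuous_toFun :=
        (continuous_const.mul (continuous_nonzeroConstCoeffs_apply 0)).subtype_mk _ }
  invFun :=
    { toFun := fun z => ⟨Fin.cons ((-1) ^ (m + 1) * z.1) 0, mul_ne_zero (by simp) z.2⟩
      continuous_toFun := by
        refine Continuous.subtype_mk (continuous_pi fun k => ?_) _
        refine Fin.cases ?_ (fun k => ?_) k
        · simp only [Fin.cons_zero]
          fun_prop
        · simpa using continuous_const }
  left_inv := ⟨
    { toFun := fun p => ⟨Fin.cons (p.2.1 0) fun k => (p.1 : ℂ) * p.2.1 k.succ, p.2.2⟩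
      continuous_toFun := by
        refine Continuous.subtype_mk (continuous_pi fun k => ?_) _
        refine Fin.cases ?_ (fun k => ?_) k
        · exact
            (continuous_nonzeroConstCoeffs_apply 0).comp continuous_snd
        · exact
            (Complex.continuous_ofReal.comp (continuous_subtype_val.comp continuous_fst)).mul
              ((continuous_nonzeroConstCoeffs_apply k.succ).comp continuous_snd)
      map_zero_left := fun w => Subtype.ext <| funext fun k => by
        refine Fin.cases ?_ (fun k => ?_) k
        · simp [← mul_assoc, ← mul_pow]
        · simp
      map_one_left := fun w => Subtype.ext <| funext fun k => by
        refine Fin.cases ?_ (fun k => ?_) k <;> simp }⟩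
  right_inv := by
    convert ContinuousMap.Homotopic.refl _
    ext z
    simp [← mul_assoc, ← mul_pow]

/-- For `n ≥ 1`, the map `μ : Sym^n(ℂ∖{0}) → ℂ∖{0}` sending the class of
`(z_1, …, z_n)` to the product `z_1 ⋯ z_n` is a continuous map which is a
homotopy equivalence. -/
theorem symProd_punctured_plane_product_homotopyEquiv (n : ℕ) (hn : 1 ≤ n)
    (μ : SymProd n {z : ℂ // z ≠ 0} → {z : ℂ // z ≠ 0})
    (hμ : ∀ f : Fin n → {z : ℂ // z ≠ 0},
      μ (SymProd.mk f) =
        ⟨∏ i, (f i : ℂ), Finset.prod_ne_zero_iff.mpr fun i _ => (f i).2⟩) :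
    Continuous μ ∧
      ∃ h : ContinuousMap.HomotopyEquiv (SymProd n {z : ℂ // z ≠ 0}) {z : ℂ // z ≠ 0},
        ∀ x, h.toFun x = μ x := by
  obtain ⟨m, rfl⟩ : ∃ m, n = m + 1 := ⟨n - 1, by omega⟩
  let h := ((SymProd.isHomeomorph_toCoeffs m).homeomorph _).toHomotopyEquiv.trans
    (nonzeroConstCoeffsHomotopyEquiv m)
  have h_eq : ∀ x, h.toFun x = μ x := by
    rintro ⟨f⟩
    refine Eq.trans (Subtype.ext ?_) (hμ f).symm
    change (-1) ^ (m + 1) * rootsToCoeffs (m + 1) (fun i => (f i : ℂ)) 0 = ∏ i, (f i : ℂ)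
    rw [rootsToCoeffs_zero, ← mul_assoc, ← mul_pow]
    simp
  exact ⟨(funext h_eq : ⇑h.toFun = μ) ▸ h.toFun.continuous, h, h_eq⟩
end

section
/- Let k ≥ 1 and let W_k denote the wedge of k circles, i.e. the quotient of (Fin k) × S^1 obtained by collapsing the set (Fin k) × {1} to a single point. For every n with n ≥ k, the fundamental group of Sym^n(W_k) (based at the class of the constant n-tuple at the wedge point) is isomorphic to ℤ^k. -/
/-- The relation on `(Fin k) × S^1` identifying all the points `(i, 1)`. -/
def WedgeRel (k : ℕ) (p q : Fin k × Circle) : Prop :=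
  p.2 = 1 ∧ q.2 = 1

/-- The wedge of `k` circles: the quotient of `(Fin k) × S^1` collapsing the
set `(Fin k) × {1}` to a single point, with the quotient topology. -/
def WedgeOfCircles (k : ℕ) : Type := Quot (WedgeRel k)

instance (k : ℕ) : TopologicalSpace (WedgeOfCircles k) :=
  inferInstanceAs (TopologicalSpace (Quot (WedgeRel k)))

/-- A section `s` of `r` induces an isomorphism on fundamental groups as soon as the identity is
homotopic, relative to the base point, to a map with values in the range of `s`. -/
theorem FundamentalGroup.map_bijective_of_homotopy {X Y : Type*} [TopologicalSpace X]
    [TopologicalSpace Y] (s : C(X, Y)) (r : C(Y, X)) (x₀ : X) (hrs : ∀ x, r (s x) = x)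
    (H : C(Y × unitInterval, Y)) (H_zero : ∀ y, H (y, 0) = y)
    (H_one : ∀ y, s (r (H (y, 1))) = H (y, 1)) (H_base : ∀ u, H (s x₀, u) = s x₀) :
    Function.Bijective (FundamentalGroup.map s x₀) := by
  constructor
  · rintro ⟨γ⟩ ⟨γ'⟩ h
    have h' : (γ.map s.continuous).Homotopic (γ'.map s.continuous) := Quotient.exact h
    obtain ⟨F⟩ := h'
    refine Quotient.sound ⟨?_⟩
    exact
      { toFun := fun p => r (F p)
        continuous_toFun := by fun_prop
        map_zero_left := fun u => by simp [hrs]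
        map_one_left := fun u => by simp [hrs]
        prop' := fun u v hv => by
          have := F.eq_fst u hv
          simp [this, hrs] }
  · rintro ⟨δ⟩
    let γ : Path x₀ x₀ :=
      { toFun := fun u => r (H (δ u, 1))
        continuous_toFun := by fun_prop
        source' := by simp [H_base, hrs]
        target' := by simp [H_base, hrs] }
    refine ⟨Path.Homotopic.Quotient.mk γ, ?_⟩
    refine Quotient.sound (Path.Homotopic.symm ⟨?_⟩)
    exact
      { toFun := fun p => H (δ p.2, p.1)
        continuous_toFun := by fun_prop
        map_zero_left := fun u => by simp [H_zero]
        map_one_left := fun u => by simp [γ, H_one]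
        prop' := by
          rintro u v (rfl | rfl) <;> simp [H_base] }

/-- The covering `ℝ → S^1`, `t ↦ exp (2 π i t)`, with kernel `ℤ`. -/
noncomputable def circleExp (t : ℝ) : Circle := Circle.exp (2 * Real.pi * t)

theorem continuous_circleExp : Continuous circleExp := by
  unfold circleExp; fun_prop

theorem circleExp_eq_iff {s t : ℝ} : circleExp s = circleExp t ↔ ∃ m : ℤ, s = t + m := by
  have := Real.pi_pos
  rw [circleExp, circleExp, Circle.exp_eq_exp]
  refine exists_congr fun m => ⟨fun h => ?_, fun h => ?_⟩
  · have : 2 * Real.pi * s = 2 * Real.pi * (t + m) := by linarith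
    exact mul_left_cancel₀ (by positivity) this
  · rw [h]; ring

@[simp] theorem circleExp_zero : circleExp 0 = 1 := by simp [circleExp]

@[simp] theorem circleExp_one : circleExp 1 = 1 := by
  rw [← circleExp_zero, circleExp_eq_iff]; exact ⟨1, by simp⟩

theorem exists_circleExp_eq (z : Circle) : ∃ t ∈ Set.Icc (0 : ℝ) 1, circleExp t = z := by
  obtain ⟨x, rfl⟩ := Circle.isAddQuotientCoveringMap_exp.surjective z
  have hpi := Real.pi_pos
  refine ⟨Int.fract (x / (2 * Real.pi)), ⟨Int.fract_nonneg _, (Int.fract_lt_one _).le⟩, ?_⟩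
  have : Circle.exp x = circleExp (x / (2 * Real.pi)) := by
    unfold circleExp; congr 1; field_simp
  rw [this, circleExp_eq_iff]
  refine ⟨-⌊x / (2 * Real.pi)⌋, ?_⟩
  rw [Int.fract]; push_cast; ring

theorem isOpenQuotientMap_circleExp : IsOpenQuotientMap circleExp := by
  have hpi := Real.pi_pos
  exact Circle.isAddQuotientCoveringMap_exp.isOpenQuotientMap.comp
    (Homeomorph.mulLeft₀ (2 * Real.pi) (by positivity)).isOpenQuotientMap

/-- The embedding of `ℤ^ι` in `ℝ^ι` as the lattice of integer vectors. -/
def intVectorHom (ι : Type*) : (ι → ℤ) →+ (ι → ℝ) where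
  toFun v i := v i
  map_zero' := by ext; simp
  map_add' _ _ := by ext; simp

theorem intVectorHom_injective (ι : Type*) : Function.Injective (intVectorHom ι) := fun v w h =>
  funext fun i => by simpa [intVectorHom] using congrFun h i

theorem nonempty_fundamentalGroup_torus (ι : Type*) [Finite ι] (x : ι → Circle) :
    Nonempty (FundamentalGroup (ι → Circle) x ≃* Multiplicative (ι → ℤ)) := by
  have hq : IsOpenQuotientMap (Pi.map fun _ : ι => circleExp) :=
    IsOpenQuotientMap.piMap fun _ => isOpenQuotientMap_circleExp
  have hd : IsDiscrete ((intVectorHom ι).range : Set (ι → ℝ)) := by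
    have : Topology.IsEmbedding (Pi.map fun (_ : ι) (m : ℤ) => (m : ℝ)) :=
      Topology.IsEmbedding.piMap fun _ => Int.isClosedEmbedding_coe_real.isEmbedding
    exact this.isDiscrete_range
  have hcov : IsAddQuotientCoveringMap (Pi.map fun _ : ι => circleExp) (intVectorHom ι).range := by
    refine hq.isQuotientMap.isAddQuotientCoveringMap_of_addSubgroup _ hd fun {a b} => ?_
    simp only [funext_iff, Pi.map_apply, AddMonoidHom.mem_range, intVectorHom,
      AddMonoidHom.coe_mk, ZeroHom.coe_mk, Pi.add_apply, Pi.neg_apply]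
    constructor
    · intro h
      choose m hm using fun i => circleExp_eq_iff.1 (h i)
      exact ⟨fun i => -m i, fun i => by rw [hm i]; push_cast; ring⟩
    · rintro ⟨m, hm⟩ i
      exact circleExp_eq_iff.2 ⟨-m i, by push_cast; linarith [hm i]⟩
  obtain ⟨e, he⟩ := hcov.surjective x
  let φ : (intVectorHom ι).range ≃+ (ι → ℤ) :=
    (AddMonoidHom.ofInjective (intVectorHom_injective ι)).symm
  exact ⟨((hcov.fundamentalGroupEquiv ⟨e, he⟩).trans
    (MulOpposite.opMulEquiv (M := Multiplicative (intVectorHom ι).range)).symm).trans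
    (AddEquiv.toMultiplicative φ)⟩

theorem exists_perm_of_card_fiber_eq {ι α : Type*} [Fintype ι] [DecidableEq α] (f g : ι → α)
    (b : α) (h : ∀ x ≠ b, (Finset.univ.filter fun j => f j = x).card =
      (Finset.univ.filter fun j => g j = x).card) : ∃ σ : Equiv.Perm ι, f ∘ σ = g := by
  have hb : ∀ x, (Finset.univ.filter fun j => f j = x).card =
      (Finset.univ.filter fun j => g j = x).card := by
    intro x
    rcases ne_or_eq x b with hx | rfl
    · exact h x hx
    let S : Finset α := insert x (Finset.univ.image f ∪ Finset.univ.image g)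
    have hf : ∑ y ∈ S, (Finset.univ.filter fun j => f j = y).card = Fintype.card ι :=
      (Finset.card_eq_sum_card_fiberwise fun j _ => by simp [S]).symm
    have hg : ∑ y ∈ S, (Finset.univ.filter fun j => g j = y).card = Fintype.card ι :=
      (Finset.card_eq_sum_card_fiberwise fun j _ => by simp [S]).symm
    have hxS : x ∈ S := by simp [S]
    rw [← Finset.add_sum_erase _ _ hxS] at hf hg
    have := Finset.sum_congr rfl fun y (hy : y ∈ S.erase x) => h y (Finset.ne_of_mem_erase hy)
    omega
  have e : ∀ x, {j // g j = x} ≃ {j // f j = x} := fun x =>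
    Fintype.equivOfCardEq (by rw [Fintype.card_subtype, Fintype.card_subtype, hb x])
  exact ⟨Equiv.ofFiberEquiv e, funext fun j => Equiv.ofFiberEquiv_map e j⟩

namespace SymProd

variable {n : ℕ} {X : Type*}

theorem mk_surjective : Function.Surjective (mk : (Fin n → X) → SymProd n X) :=
  Quot.mk_surjective

theorem mk_eq_mk_iff {f g : Fin n → X} : mk f = mk g ↔ ∃ σ : Equiv.Perm (Fin n), f ∘ σ = g :=
  Quotient.eq (r := permSetoid n X)

variable [TopologicalSpace X]

theorem isOpenQuotientMap_mk : IsOpenQuotientMap (mk : (Fin n → X) → SymProd n X) where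
  surjective := mk_surjective
  continuous := continuous_quot_mk
  isOpenMap U hU := by
    have : (mk ⁻¹' (mk '' U) : Set (Fin n → X)) =
        ⋃ σ : Equiv.Perm (Fin n), (fun f => f ∘ σ) ⁻¹' U := by
      ext g
      simp only [Set.mem_preimage, Set.mem_image, Set.mem_iUnion]
      constructor
      · rintro ⟨f, hf, hfg⟩
        obtain ⟨σ, rfl⟩ := mk_eq_mk_iff.1 hfg.symm
        exact ⟨σ, hf⟩
      · rintro ⟨σ, hσ⟩
        exact ⟨_, hσ, (mk_eq_mk_iff.2 ⟨σ, rfl⟩).symm⟩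
    change IsOpen (mk ⁻¹' (mk '' U) : Set (Fin n → X))
    rw [this]
    exact isOpen_iUnion fun σ => hU.preimage (by fun_prop)

theorem continuous_mk_s7 : Continuous (mk : (Fin n → X) → SymProd n X) :=
  isOpenQuotientMap_mk.continuous

instance [T2Space X] : T2Space (SymProd n X) := by
  rw [t2Space_iff_of_isOpenQuotientMap isOpenQuotientMap_mk]
  have : {q : (Fin n → X) × (Fin n → X) | mk q.1 = mk q.2} =
      ⋃ σ : Equiv.Perm (Fin n), {q | q.1 ∘ σ = q.2} := by
    ext q; simp [mk_eq_mk_iff]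
  rw [this]
  exact isClosed_iUnion_of_finite fun σ => isClosed_eq (by fun_prop) (by fun_prop)

end SymProd

namespace WedgeOfCircles

variable {k : ℕ}

/-- The point `z` of the `i`-th circle. -/
def pt (i : Fin k) (z : Circle) : WedgeOfCircles k := Quot.mk (WedgeRel k) (i, z)

theorem exists_eq_pt (x : WedgeOfCircles k) : ∃ i z, x = pt i z := by
  obtain ⟨⟨i, z⟩, rfl⟩ := Quot.mk_surjective x
  exact ⟨i, z, rfl⟩

theorem pt_one (i j : Fin k) : pt i 1 = pt j 1 := Quot.sound ⟨rfl, rfl⟩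

theorem continuous_pt : Continuous fun p : Fin k × Circle => pt p.1 p.2 := continuous_quot_mk

/-- The retraction of the wedge onto its `i`-th circle. -/
noncomputable def proj (i : Fin k) : WedgeOfCircles k → Circle :=
  Quot.lift (fun p => if p.1 = i then p.2 else 1) fun p q h => by simp [h.1, h.2]

theorem proj_pt (i j : Fin k) (z : Circle) : proj i (pt j z) = if j = i then z else 1 := rfl

theorem continuous_proj (i : Fin k) : Continuous (proj i) := by
  refine continuous_quot_lift _ ?_
  refine continuous_prod_of_discrete_left.2 fun j => ?_
  dsimp only
  split_ifs <;> fun_prop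

theorem eq_pt_iff {i : Fin k} {z : Circle} (hz : z ≠ 1) (x : WedgeOfCircles k) :
    x = pt i z ↔ proj i x = z := by
  constructor
  · rintro rfl; simp [proj_pt]
  · obtain ⟨j, w, rfl⟩ := exists_eq_pt x
    rw [proj_pt]
    split_ifs with h
    · rintro rfl; rw [h]
    · intro h'; exact absurd h'.symm hz

theorem ext_proj {x y : WedgeOfCircles k} (h : ∀ i, proj i x = proj i y) : x = y := by
  obtain ⟨i, z, rfl⟩ := exists_eq_pt x
  obtain ⟨j, w, rfl⟩ := exists_eq_pt y
  by_cases hz : z = 1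
  · by_cases hw : w = 1
    · rw [hz, hw]; exact pt_one i j
    · rw [eq_pt_iff hw, h j]; simp [proj_pt]
  · symm; rw [eq_pt_iff hz, ← h i]; simp [proj_pt]

instance : T2Space (WedgeOfCircles k) :=
  T2Space.of_injective_continuous (f := fun x i => proj i x)
    (fun _ _ h => ext_proj fun i => congrFun h i) (continuous_pi continuous_proj)

end WedgeOfCircles

open WedgeOfCircles in
open Classical in
theorem SymProd.mk_eq_mk_iff_card_proj {k n : ℕ} {f g : Fin n → WedgeOfCircles k} :
    mk f = mk g ↔ ∀ i, ∀ z ≠ 1, (Finset.univ.filter fun j => proj i (f j) = z).card =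
      (Finset.univ.filter fun j => proj i (g j) = z).card := by
  rw [mk_eq_mk_iff]
  constructor
  · rintro ⟨σ, rfl⟩ i z -
    symm
    exact Finset.card_equiv σ (by simp)
  · intro h
    rcases isEmpty_or_nonempty (Fin n) with hn | ⟨⟨j₀⟩⟩
    · exact ⟨1, Subsingleton.elim _ _⟩
    obtain ⟨i₀, -, -⟩ := exists_eq_pt (f j₀)
    refine exists_perm_of_card_fiber_eq f g (pt i₀ 1) fun x hx => ?_
    obtain ⟨i, z, rfl⟩ := exists_eq_pt x
    have hz : z ≠ 1 := by
      rintro rfl; exact hx (pt_one _ _)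
    simpa only [eq_pt_iff hz] using h i z hz

namespace SymProd

open WedgeOfCircles

variable {k n : ℕ}

/-- The map `Sym^n (W_k) → (S^1)^k` multiplying the points lying on each circle. -/
noncomputable def toTorus : C(SymProd n (WedgeOfCircles k), Fin k → Circle) where
  toFun := Quotient.lift (fun f i => ∏ j, proj i (f j)) fun f g h => by
    obtain ⟨σ, rfl⟩ := h
    funext i
    exact (Equiv.prod_comp σ fun j => proj i (f j)).symm
  continuous_toFun := by
    refine continuous_quot_lift _ (continuous_pi fun i => continuous_finsetProd _ fun j _ => ?_)
    exact (continuous_proj i).comp (continuous_apply j)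

theorem toTorus_mk (f : Fin n → WedgeOfCircles k) (i : Fin k) :
    toTorus (mk f) i = ∏ j, proj i (f j) := rfl

/-- The tuple with one point on each circle, completed with the wedge point. -/
noncomputable def torusTuple (hk : 0 < k) (z : Fin k → Circle) (j : Fin n) : WedgeOfCircles k :=
  if h : (j : ℕ) < k then pt ⟨j, h⟩ (z ⟨j, h⟩) else pt ⟨0, hk⟩ 1

theorem proj_torusTuple (hk : 0 < k) (z : Fin k → Circle) (i : Fin k) (j : Fin n) :
    proj i (torusTuple hk z j) = if (j : ℕ) = i then z i else 1 := by
  unfold torusTuple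
  split_ifs with h₁ h₂ h₂
  · obtain rfl : (⟨j, h₁⟩ : Fin k) = i := Fin.ext h₂
    simp [proj_pt]
  · rw [proj_pt, if_neg fun h => h₂ (congrArg Fin.val h)]
  · omega
  · simp [proj_pt]

/-- The map `(S^1)^k → Sym^n (W_k)` putting one point on each circle. -/
noncomputable def ofTorus (hk : 0 < k) : C(Fin k → Circle, SymProd n (WedgeOfCircles k)) where
  toFun z := mk (torusTuple hk z)
  continuous_toFun := by
    refine continuous_mk_s7.comp (continuous_pi fun j => ?_)
    unfold torusTuple
    split_ifs with h
    · exact continuous_pt.comp (by fun_prop : Continuous fun z : Fin k → Circle =>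
        ((⟨j, h⟩ : Fin k), z ⟨j, h⟩))
    · fun_prop

theorem toTorus_ofTorus (hk : 0 < k) (hn : k ≤ n) (z : Fin k → Circle) :
    toTorus (ofTorus (n := n) hk z) = z := by
  funext i
  change toTorus (mk (torusTuple hk z)) i = z i
  rw [toTorus_mk, Finset.prod_eq_single (Fin.castLE hn i)]
  · simp [proj_torusTuple]
  · intro j _ hj
    rw [proj_torusTuple, if_neg]
    exact fun h => hj (Fin.ext h)
  · simp

/-- At most one of the points of the tuple lies on each circle, away from the wedge point. -/
def AtMostOneOnEachCircle (f : Fin n → WedgeOfCircles k) : Prop :=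
  ∀ i j j', proj i (f j) ≠ 1 → proj i (f j') ≠ 1 → j = j'

open Classical in
theorem AtMostOneOnEachCircle.card_proj {f : Fin n → WedgeOfCircles k}
    (hf : AtMostOneOnEachCircle f) (i : Fin k) {z : Circle} (hz : z ≠ 1) :
    (Finset.univ.filter fun j => proj i (f j) = z).card =
      if toTorus (mk f) i = z then 1 else 0 := by
  rw [toTorus_mk]
  by_cases h : ∃ j, proj i (f j) ≠ 1
  · obtain ⟨j, hj⟩ := h
    have h1 : ∀ j' ≠ j, proj i (f j') = 1 := fun j' hj' => by
      by_contra h; exact hj' (hf i j' j h hj)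
    rw [Finset.prod_eq_single j (fun j' _ h => h1 j' h) (by simp)]
    split_ifs with h2
    · rw [Finset.card_eq_one]
      refine ⟨j, Finset.eq_singleton_iff_unique_mem.2 ⟨by simp [h2], fun j' hj' => ?_⟩⟩
      by_contra h3
      simp only [Finset.mem_filter, h1 j' h3] at hj'
      exact hz hj'.2.symm
    · rw [Finset.card_eq_zero, Finset.filter_eq_empty_iff]
      intro j' _ hj'
      rcases eq_or_ne j' j with rfl | h3
      · exact h2 hj'
      · exact hz (by rw [← hj', h1 j' h3])
  · push Not at h
    simp [h, hz.symm]

theorem ofTorus_toTorus (hk : 0 < k) (hn : k ≤ n) {f : Fin n → WedgeOfCircles k}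
    (hf : AtMostOneOnEachCircle f) : ofTorus hk (toTorus (mk f)) = mk f := by
  classical
  have hg : AtMostOneOnEachCircle (torusTuple (n := n) hk (toTorus (mk f))) := by
    intro i j j' h h'
    simp only [proj_torusTuple, ne_eq, ite_eq_right_iff, Classical.not_imp] at h h'
    exact Fin.ext (h.1.trans h'.1.symm)
  change mk (torusTuple hk _) = mk f
  rw [mk_eq_mk_iff_card_proj]
  intro i z hz
  rw [hf.card_proj i hz, hg.card_proj i hz]
  congr 2
  exact congrFun (toTorus_ofTorus hk hn _) i

end SymProd

/-- The retraction of `ℝ` onto `[0, 1]`. -/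
noncomputable def clampUnit (a : ℝ) : ℝ := max 0 (min 1 a)

theorem continuous_clampUnit : Continuous clampUnit := by
  unfold clampUnit; fun_prop

theorem clampUnit_of_nonpos {a : ℝ} (h : a ≤ 0) : clampUnit a = 0 :=
  max_eq_left ((min_le_right _ _).trans h)

theorem clampUnit_of_one_le {a : ℝ} (h : 1 ≤ a) : clampUnit a = 1 := by
  simp [clampUnit, h]

/-- The straight-line homotopy from a list `l` in `[0, 1]` to the list
`clampUnit a, clampUnit (a - 1), clampUnit (a - 2), …` of the same length. -/
noncomputable def spread (u : ℝ) : ℝ → List ℝ → List ℝ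
  | _, [] => []
  | a, x :: l => ((1 - u) * x + u * clampUnit a) :: spread u (a - 1) l

theorem spread_eq_mapIdx (u a : ℝ) (l : List ℝ) :
    spread u a l = l.mapIdx fun r x => (1 - u) * x + u * clampUnit (a - r) := by
  induction l generalizing a with
  | nil => rfl
  | cons x l ih =>
    rw [spread, ih, List.mapIdx_cons]
    congr 1
    · simp
    · congr 1; funext r x; push_cast; ring_nf

/-- The sublist of the elements lying in the open interval `(0, 1)`. -/
noncomputable def interiorPart (l : List ℝ) : List ℝ := l.filter fun x => 0 < x ∧ x < 1

theorem mem_interiorPart {l : List ℝ} {x : ℝ} : x ∈ interiorPart l ↔ x ∈ l ∧ 0 < x ∧ x < 1 := by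
  simp [interiorPart]

theorem sum_interiorPart {l : List ℝ} (hl : ∀ x ∈ l, 0 ≤ x ∧ x < 1) :
    (interiorPart l).sum = l.sum := by
  induction l with
  | nil => rfl
  | cons x l ih =>
    simp only [List.forall_mem_cons] at hl
    have ih := ih hl.2
    unfold interiorPart at ih ⊢
    rcases hl.1.1.eq_or_lt with rfl | hx
    · simpa using ih
    · simpa [hx, hl.1.2] using ih

theorem sum_interiorPart_le (l : List ℝ) : (interiorPart l).sum ≤ (interiorPart l).length := by
  have := List.sum_le_card_nsmul (interiorPart l) 1 fun x hx => (mem_interiorPart.1 hx).2.2.le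
  simpa using this

section Spread

variable {P : ℝ → Bool} (hP₀ : P 0 = false) (hP₁ : P 1 = false) (u : ℝ)
include hP₀

theorem countP_spread_of_eq_zero {l : List ℝ} (hl : ∀ x ∈ l, x = 0) {a : ℝ} (ha : a ≤ 0) :
    (spread u a l).countP P = 0 := by
  induction l generalizing a with
  | nil => rfl
  | cons x l ih =>
    simp only [List.forall_mem_cons] at hl
    rw [spread, hl.1, clampUnit_of_nonpos ha, List.countP_cons, ih hl.2 (by linarith)]
    simp [hP₀]

theorem countP_spread_of_lt_one {l : List ℝ} (hl : ∀ x ∈ l, 0 ≤ x ∧ x < 1)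
    (hs : l.Pairwise (· ≥ ·)) {a : ℝ} (ha : a ≤ (interiorPart l).length) :
    (spread u a l).countP P = (spread u a (interiorPart l)).countP P := by
  induction l generalizing a with
  | nil => rfl
  | cons x l ih =>
    simp only [List.forall_mem_cons] at hl
    rw [List.pairwise_cons] at hs
    rcases hl.1.1.eq_or_lt with rfl | hx
    · have h0 : ∀ y ∈ (0 : ℝ) :: l, y = 0 := by
        simp only [List.forall_mem_cons, true_and]
        exact fun y hy => le_antisymm (hs.1 y hy) (hl.2 y hy).1
      have hi : interiorPart ((0 : ℝ) :: l) = [] := by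
        refine List.eq_nil_iff_forall_not_mem.2 fun y hy => ?_
        have := mem_interiorPart.1 hy
        exact this.2.1.ne' (h0 y this.1)
      rw [hi] at ha ⊢
      rw [countP_spread_of_eq_zero hP₀ u h0 (by simpa using ha)]
      rfl
    · have hi : interiorPart (x :: l) = x :: interiorPart l := by
        simp [interiorPart, hx, hl.1.2]
      rw [hi] at ha ⊢
      rw [spread, spread, List.countP_cons, List.countP_cons, ih hl.2 hs.2]
      rw [List.length_cons] at ha
      push_cast at ha
      linarith

include hP₁

theorem countP_spread_sum {l : List ℝ} (hl : ∀ x ∈ l, 0 ≤ x ∧ x ≤ 1)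
    (hs : l.Pairwise (· ≥ ·)) :
    (spread u l.sum l).countP P =
      (spread u (interiorPart l).sum (interiorPart l)).countP P := by
  induction l with
  | nil => rfl
  | cons x l ih =>
    have hl' := hl
    have hs' := hs
    simp only [List.forall_mem_cons] at hl
    rw [List.pairwise_cons] at hs
    rcases hl.1.2.eq_or_lt with rfl | hx
    · have hi : interiorPart ((1 : ℝ) :: l) = interiorPart l := by simp [interiorPart]
      have h0 : 0 ≤ l.sum := List.sum_nonneg fun x hx => (hl.2 x hx).1
      rw [hi, List.sum_cons, spread, List.countP_cons, clampUnit_of_one_le (by linarith),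
        add_sub_cancel_left, ih hl.2 hs.2]
      simp [hP₁]
    · have hlt : ∀ y ∈ x :: l, 0 ≤ y ∧ y < 1 := fun y hy =>
        ⟨(hl' y hy).1, by
          rcases List.mem_cons.1 hy with rfl | hy
          · exact hx
          · exact (hs.1 y hy).trans_lt hx⟩
      rw [sum_interiorPart hlt]
      refine countP_spread_of_lt_one hP₀ u hlt hs' ?_
      rw [← sum_interiorPart hlt]
      exact sum_interiorPart_le _

end Spread

namespace SymProd

open WedgeOfCircles

variable {k n : ℕ}

/-- The indices of the points lying on the `i`-th circle. -/
def colorIndices (c : Fin n → Fin k) (i : Fin k) : List (Fin n) :=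
  (List.finRange n).filter fun j => c j = i

theorem mem_colorIndices {c : Fin n → Fin k} {i : Fin k} {j : Fin n} :
    j ∈ colorIndices c i ↔ c j = i := by simp [colorIndices]

theorem nodup_colorIndices (c : Fin n → Fin k) (i : Fin k) : (colorIndices c i).Nodup :=
  (List.nodup_finRange n).filter _

/-- The tuple of points with angles `2 π t j` on the circles `c j`. -/
noncomputable def angleTuple (p : (Fin n → Fin k) × (Fin n → ℝ)) (j : Fin n) : WedgeOfCircles k :=
  pt (p.1 j) (circleExp (p.2 j))

theorem continuous_angleTuple : Continuous (angleTuple (k := k) (n := n)) := by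
  refine continuous_pi fun j => ?_
  have := continuous_circleExp
  have h : Continuous fun p : (Fin n → Fin k) × (Fin n → ℝ) => (p.1 j, circleExp (p.2 j)) := by
    fun_prop
  exact continuous_pt.comp h

open Classical in
theorem card_proj_angleTuple (p : (Fin n → Fin k) × (Fin n → ℝ)) (i : Fin k) {z : Circle}
    (hz : z ≠ 1) : (Finset.univ.filter fun j => proj i (angleTuple p j) = z).card =
      ((colorIndices p.1 i).map p.2).countP fun x => circleExp x = z := by
  have h : ∀ j, proj i (angleTuple p j) = z ↔ circleExp (p.2 j) = z ∧ p.1 j = i := by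
    intro j
    rw [angleTuple, proj_pt]
    split_ifs with h
    · simp [h]
    · simp [h, hz.symm]
  rw [List.countP_map, colorIndices, List.countP_filter, List.countP_eq_length_filter]
  rw [← List.toFinset_card_of_nodup ((List.nodup_finRange n).filter _)]
  congr 1
  ext j
  simp [h]

open Classical in
theorem mk_angleTuple_eq_iff {p q : (Fin n → Fin k) × (Fin n → ℝ)} :
    mk (angleTuple p) = mk (angleTuple q) ↔ ∀ i, ∀ z ≠ 1,
      ((colorIndices p.1 i).map p.2).countP (fun x => circleExp x = z) =
        ((colorIndices q.1 i).map q.2).countP (fun x => circleExp x = z) := by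
  rw [mk_eq_mk_iff_card_proj]
  refine forall_congr' fun i => forall₂_congr fun z hz => ?_
  rw [card_proj_angleTuple p i hz, card_proj_angleTuple q i hz]

/-- The angles in `[0, 1]`, decreasing along the points of each circle. -/
def sortedAngles (k n : ℕ) : Set ((Fin n → Fin k) × (Fin n → ℝ)) :=
  {p | (∀ j, p.2 j ∈ Set.Icc (0 : ℝ) 1) ∧ ∀ i j, i < j → p.1 i = p.1 j → p.2 j ≤ p.2 i}

theorem isCompact_sortedAngles : IsCompact (sortedAngles k n) := by
  have hK : IsCompact ((Set.univ : Set (Fin n → Fin k)) ×ˢ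
      (Set.univ.pi fun _ : Fin n => Set.Icc (0 : ℝ) 1)) :=
    isCompact_univ.prod (isCompact_univ_pi fun _ => isCompact_Icc)
  refine hK.of_isClosed_subset ?_ fun p hp => ⟨trivial, fun j _ => hp.1 j⟩
  have h : sortedAngles k n = (⋂ j, {p | p.2 j ∈ Set.Icc (0 : ℝ) 1}) ∩
      ⋂ i, ⋂ j, ⋂ (_ : i < j), ({p | ¬ p.1 i = p.1 j} ∪ {p | p.2 j ≤ p.2 i}) := by
    ext
    simp [sortedAngles, imp_iff_not_or]
  rw [h]
  refine IsClosed.inter (isClosed_iInter fun j => isClosed_Icc.preimage (by fun_prop)) ?_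
  refine isClosed_iInter fun i => isClosed_iInter fun j => isClosed_iInter fun _ => ?_
  refine IsClosed.union ?_ (isClosed_le (by fun_prop) (by fun_prop))
  exact (isClosed_discrete {c : Fin n → Fin k | ¬ c i = c j}).preimage continuous_fst

theorem exists_sortedAngles (y : SymProd n (WedgeOfCircles k)) :
    ∃ p ∈ sortedAngles k n, mk (angleTuple p) = y := by
  obtain ⟨f, rfl⟩ := mk_surjective y
  choose c z hz using fun j => exists_eq_pt (f j)
  choose t ht htz using fun j => exists_circleExp_eq (z j)
  let σ := Tuple.sort fun j => toLex (c j, OrderDual.toDual (t j))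
  have hσ := Tuple.monotone_sort fun j => toLex (c j, OrderDual.toDual (t j))
  refine ⟨(c ∘ σ, t ∘ σ), ⟨fun j => ht _, fun i j hij h => ?_⟩, ?_⟩
  · rcases Prod.Lex.le_iff.1 (hσ hij.le) with h' | h'
    · exact absurd h h'.ne
    · exact h'.2
  · refine (mk_eq_mk_iff.2 ⟨σ, ?_⟩).symm
    funext j
    simp [angleTuple, htz, ← hz]

theorem isQuotientMap_angleTuple_prod : Topology.IsQuotientMap
    fun q : sortedAngles k n × unitInterval => (mk (angleTuple q.1.1), q.2) := by
  have : CompactSpace (sortedAngles k n) := isCompact_iff_compactSpace.1 isCompact_sortedAngles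
  refine Topology.IsQuotientMap.of_surjective_continuous ?_ ?_
  · rintro ⟨y, u⟩
    obtain ⟨p, hp, rfl⟩ := exists_sortedAngles y
    exact ⟨(⟨p, hp⟩, u), rfl⟩
  · have := continuous_mk_s7.comp (continuous_angleTuple (k := k) (n := n))
    exact (this.comp (continuous_subtype_val.comp continuous_fst)).prodMk continuous_snd

/-- The homotopy spreading the angles on each circle so that at most one of them stays inside
the open interval `(0, 1)`, while their sum is preserved. -/
noncomputable def spreadAngles (q : (Fin n → Fin k) × (Fin n → ℝ) × ℝ) :
    (Fin n → Fin k) × (Fin n → ℝ) :=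
  (q.1, fun j => (1 - q.2.2) * q.2.1 j + q.2.2 *
    clampUnit (((colorIndices q.1 (q.1 j)).map q.2.1).sum - (colorIndices q.1 (q.1 j)).idxOf j))

theorem continuous_spreadAngles : Continuous (spreadAngles (k := k) (n := n)) := by
  refine continuous_prod_of_discrete_left.2 fun c => ?_
  refine continuous_const.prodMk (continuous_pi fun j => ?_)
  have h : Continuous fun q : (Fin n → ℝ) × ℝ => ((colorIndices c (c j)).map q.1).sum :=
    continuous_list_sum (f := fun (l : Fin n) (q : (Fin n → ℝ) × ℝ) => q.1 l) _
      fun l _ => by fun_prop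
  have := continuous_clampUnit
  dsimp only
  fun_prop

theorem map_spreadAngles (p : (Fin n → Fin k) × (Fin n → ℝ)) (u : ℝ) (i : Fin k) :
    (colorIndices p.1 i).map (spreadAngles (p.1, p.2, u)).2 =
      spread u ((colorIndices p.1 i).map p.2).sum ((colorIndices p.1 i).map p.2) := by
  rw [spread_eq_mapIdx]
  refine List.ext_getElem (by simp) fun r h _ => ?_
  have hr : r < (colorIndices p.1 i).length := by simpa using h
  have hc : p.1 (colorIndices p.1 i)[r] = i := mem_colorIndices.1 (List.getElem_mem hr)
  simp [spreadAngles, hc, (nodup_colorIndices p.1 i).idxOf_getElem]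

theorem pairwise_map_of_mem_sortedAngles {p : (Fin n → Fin k) × (Fin n → ℝ)}
    (hp : p ∈ sortedAngles k n) (i : Fin k) :
    ((colorIndices p.1 i).map p.2).Pairwise (· ≥ ·) := by
  rw [List.pairwise_map]
  have h : (colorIndices p.1 i).Pairwise (· < ·) := (List.pairwise_lt_finRange n).filter _
  exact h.imp_of_mem fun ha hb hab =>
    hp.2 _ _ hab ((mem_colorIndices.1 ha).trans (mem_colorIndices.1 hb).symm)

theorem mem_map_of_mem_sortedAngles {p : (Fin n → Fin k) × (Fin n → ℝ)}
    (hp : p ∈ sortedAngles k n) (i : Fin k) :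
    ∀ x ∈ (colorIndices p.1 i).map p.2, 0 ≤ x ∧ x ≤ 1 := by
  intro x hx
  obtain ⟨j, -, rfl⟩ := List.mem_map.1 hx
  exact hp.1 j

theorem circleExp_ne_one {x : ℝ} (h₀ : 0 < x) (h₁ : x < 1) : circleExp x ≠ 1 := by
  rw [← circleExp_zero, Ne, circleExp_eq_iff]
  rintro ⟨m, rfl⟩
  rw [zero_add] at h₀ h₁
  norm_cast at h₀ h₁
  omega

theorem circleExp_eq_iff_of_mem {x y : ℝ} (hx : 0 < x ∧ x < 1) (hy : 0 ≤ y ∧ y ≤ 1) :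
    circleExp y = circleExp x ↔ y = x := by
  refine ⟨fun h => ?_, fun h => h ▸ rfl⟩
  obtain ⟨m, rfl⟩ := circleExp_eq_iff.1 h
  have h1 : (m : ℝ) < 1 := by linarith
  have h2 : (-1 : ℝ) < m := by linarith
  norm_cast at h1
  have h2' : -1 < m := by exact_mod_cast h2
  obtain rfl : m = 0 := by omega
  simp

open Classical in
theorem count_interiorPart {l : List ℝ} (hl : ∀ x ∈ l, 0 ≤ x ∧ x ≤ 1) {x : ℝ}
    (hx : 0 < x ∧ x < 1) :
    (interiorPart l).count x = l.countP fun y => circleExp y = circleExp x := by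
  rw [interiorPart, List.count_filter (by simpa using hx), List.count_eq_countP]
  refine List.countP_congr fun y hy => ?_
  simp [circleExp_eq_iff_of_mem hx (hl y hy)]

theorem interiorPart_eq {p q : (Fin n → Fin k) × (Fin n → ℝ)} (hp : p ∈ sortedAngles k n)
    (hq : q ∈ sortedAngles k n) (h : mk (angleTuple p) = mk (angleTuple q)) (i : Fin k) :
    interiorPart ((colorIndices p.1 i).map p.2) =
      interiorPart ((colorIndices q.1 i).map q.2) := by
  classical
  refine List.Perm.eq_of_pairwise (le := (· ≥ ·)) (fun a b _ _ hab hba => le_antisymm hba hab)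
    ((pairwise_map_of_mem_sortedAngles hp i).filter _)
    ((pairwise_map_of_mem_sortedAngles hq i).filter _) ?_
  rw [List.perm_iff_count]
  intro x
  by_cases hx : 0 < x ∧ x < 1
  · rw [count_interiorPart (mem_map_of_mem_sortedAngles hp i) hx,
      count_interiorPart (mem_map_of_mem_sortedAngles hq i) hx]
    exact mk_angleTuple_eq_iff.1 h i _ (circleExp_ne_one hx.1 hx.2)
  · rw [List.count_eq_zero_of_not_mem fun h => hx (mem_interiorPart.1 h).2,
      List.count_eq_zero_of_not_mem fun h => hx (mem_interiorPart.1 h).2]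

theorem mk_spreadAngles_congr {p q : (Fin n → Fin k) × (Fin n → ℝ)} (hp : p ∈ sortedAngles k n)
    (hq : q ∈ sortedAngles k n) (h : mk (angleTuple p) = mk (angleTuple q)) (u : ℝ) :
    mk (angleTuple (spreadAngles (p.1, p.2, u))) =
      mk (angleTuple (spreadAngles (q.1, q.2, u))) := by
  classical
  rw [mk_angleTuple_eq_iff]
  intro i z hz
  change ((colorIndices p.1 i).map _).countP _ = ((colorIndices q.1 i).map _).countP _
  rw [map_spreadAngles, map_spreadAngles,
    countP_spread_sum (by simpa using hz.symm) (by simpa using hz.symm) u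
      (mem_map_of_mem_sortedAngles hp i) (pairwise_map_of_mem_sortedAngles hp i),
    countP_spread_sum (by simpa using hz.symm) (by simpa using hz.symm) u
      (mem_map_of_mem_sortedAngles hq i) (pairwise_map_of_mem_sortedAngles hq i),
    interiorPart_eq hp hq h i]

theorem mem_Ioo_of_circleExp_clampUnit_ne_one {a : ℝ} (h : circleExp (clampUnit a) ≠ 1) :
    0 < a ∧ a < 1 := by
  constructor <;> by_contra! ha
  · exact h (by rw [clampUnit_of_nonpos ha, circleExp_zero])
  · exact h (by rw [clampUnit_of_one_le ha, circleExp_one])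

theorem atMostOneOnEachCircle_spreadAngles_one (p : (Fin n → Fin k) × (Fin n → ℝ)) :
    AtMostOneOnEachCircle (angleTuple (spreadAngles (p.1, p.2, 1))) := by
  have key : ∀ i j, proj i (angleTuple (spreadAngles (p.1, p.2, 1)) j) ≠ 1 → p.1 j = i ∧
      0 < ((colorIndices p.1 i).map p.2).sum - (colorIndices p.1 i).idxOf j ∧
      ((colorIndices p.1 i).map p.2).sum - (colorIndices p.1 i).idxOf j < 1 := by
    intro i j h
    rw [angleTuple, proj_pt] at h
    split_ifs at h with hi
    · change p.1 j = i at hi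
      refine ⟨hi, mem_Ioo_of_circleExp_clampUnit_ne_one ?_⟩
      simpa [spreadAngles, hi] using h
    · exact absurd rfl h
  intro i j j' h h'
  obtain ⟨h1, h2, h3⟩ := key i j h
  obtain ⟨h1', h2', h3'⟩ := key i j' h'
  have a : ((colorIndices p.1 i).idxOf j : ℝ) < (colorIndices p.1 i).idxOf j' + 1 := by linarith
  have b : ((colorIndices p.1 i).idxOf j' : ℝ) < (colorIndices p.1 i).idxOf j + 1 := by linarith
  norm_cast at a b
  exact (List.idxOf_inj (mem_colorIndices.2 h1)).1 (by omega)

theorem exists_homotopy (k n : ℕ) : ∃ H : C(SymProd n (WedgeOfCircles k) × unitInterval,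
    SymProd n (WedgeOfCircles k)), ∀ p ∈ sortedAngles k n, ∀ u : unitInterval,
      H (mk (angleTuple p), u) = mk (angleTuple (spreadAngles (p.1, p.2, u))) := by
  let G : C(sortedAngles k n × unitInterval, SymProd n (WedgeOfCircles k)) :=
    { toFun := fun q => mk (angleTuple (spreadAngles (q.1.1.1, q.1.1.2, q.2)))
      continuous_toFun := by
        refine continuous_mk_s7.comp (continuous_angleTuple.comp (continuous_spreadAngles.comp ?_))
        fun_prop }
  have hG : Function.FactorsThrough G
      fun q : sortedAngles k n × unitInterval => (mk (angleTuple q.1.1), q.2) := by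
    rintro ⟨⟨p, hp⟩, u⟩ ⟨⟨q, hq⟩, v⟩ h
    simp only [Prod.mk.injEq] at h
    obtain ⟨h, rfl⟩ := h
    exact mk_spreadAngles_congr hp hq h u
  let Q : C(sortedAngles k n × unitInterval, SymProd n (WedgeOfCircles k) × unitInterval) :=
    ⟨_, isQuotientMap_angleTuple_prod.continuous⟩
  have hQ : Topology.IsQuotientMap Q := isQuotientMap_angleTuple_prod
  refine ⟨hQ.lift G hG, fun p hp u => ?_⟩
  exact DFunLike.congr_fun (hQ.lift_comp G hG) (⟨p, hp⟩, u)

theorem ofTorus_one (hk : 0 < k) : ofTorus (n := n) hk 1 = mk fun _ => pt ⟨0, hk⟩ 1 := by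
  change mk (torusTuple hk 1) = _
  congr 1
  funext j
  unfold torusTuple
  split_ifs
  · exact pt_one _ _
  · rfl

end SymProd

open SymProd in
/-- For `n ≥ k ≥ 1`, the fundamental group of `Sym^n(W_k)`, based at the class
of the constant `n`-tuple at the wedge point, is isomorphic to `ℤ^k`. -/
theorem fundamentalGroup_symProd_wedge (k n : ℕ) (hk : 0 < k) (hn : k ≤ n) :
    Nonempty
      (FundamentalGroup (SymProd n (WedgeOfCircles k))
          (SymProd.mk fun _ : Fin n => Quot.mk (WedgeRel k) (⟨0, hk⟩, (1 : Circle)))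
        ≃* Multiplicative (Fin k → ℤ)) := by
  obtain ⟨H, hH⟩ := exists_homotopy k n
  obtain ⟨φ⟩ := nonempty_fundamentalGroup_torus (Fin k) 1
  change Nonempty (FundamentalGroup _ (SymProd.mk fun _ => WedgeOfCircles.pt ⟨0, hk⟩ 1) ≃* _)
  rw [← ofTorus_one hk]
  refine ⟨(MulEquiv.ofBijective _ (FundamentalGroup.map_bijective_of_homotopy (ofTorus hk)
    toTorus 1 (toTorus_ofTorus hk hn) H (fun y => ?_) (fun y => ?_) fun u => ?_)).symm.trans φ⟩
  · obtain ⟨p, hp, rfl⟩ := exists_sortedAngles y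
    rw [hH p hp]
    simp [spreadAngles]
  · obtain ⟨p, hp, rfl⟩ := exists_sortedAngles y
    rw [hH p hp]
    exact ofTorus_toTorus hk hn (atMostOneOnEachCircle_spreadAngles_one p)
  · let p : (Fin n → Fin k) × (Fin n → ℝ) := (fun _ => ⟨0, hk⟩, fun _ => 0)
    have hp : p ∈ sortedAngles k n := ⟨fun _ => by simp [p], fun _ _ _ _ => le_rfl⟩
    have hb : ofTorus (n := n) hk 1 = SymProd.mk (angleTuple p) := by
      rw [ofTorus_one]; congr 1; funext j; simp [angleTuple, p]
    rw [hb, hH p hp]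
    have : spreadAngles (p.1, p.2, (u : ℝ)) = p := by
      refine Prod.ext rfl (funext fun j => ?_)
      have h0 : ∀ l : List (Fin n), (l.map fun _ => (0 : ℝ)).sum = 0 := by simp
      simp only [spreadAngles, p, h0]
      rw [clampUnit_of_nonpos (by simp)]
      simp
    rw [this]
end
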